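/- arXiv:2312.10627 — 5 statements merged into one kernel-verified Lean document; each statement's English description precedes it below -/
import Mathlib

section
/- Let k ≥ 3 and N ≥ 1 be integers. Then every modular form f of weight k for Γ(N) decomposes as f = Σ_{λ̄ ∈ Λ_N} c_{λ̄}·E_k(·, λ̄, N) + g, where the c_{λ̄} are complex numbers and g is a cusp form of weight k for Γ(N). Equivalently, M_k(Γ(N)) = E_k(Γ(N),ℂ) + S_k(Γ(N)), where E_k(Γ(N),ℂ) denotes the ℂ-span of the Eisenstein series E_k(·, λ̄, N) for λ̄ ∈ Λ_N. -/
open scoped MatrixGroups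
open Complex UpperHalfPlane

noncomputable section

/-- normalized Eisenstein series of weight `k` on `Γ(N)`, attached to `λ̄ ∈ (ℤ/N)²`. -/
def Ek (k N : ℕ) (lam : ZMod N × ZMod N) : ℍ → ℂ :=
  fun τ => (if 3 ≤ N then (1 : ℂ) else 1/2) * ∑' cd : ℤ × ℤ,
    if Int.gcd cd.1 cd.2 = 1 ∧ (cd.1 : ZMod N) = lam.1 ∧ (cd.2 : ZMod N) = lam.2
    then ((cd.1 : ℂ) * (τ : ℂ) + (cd.2 : ℂ)) ^ (-(k : ℤ)) else 0

open Filter Topology EisensteinSeries CongruenceSubgroup Matrix ModularForm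

/-- Reduction modulo `N` on `SL(2, ℤ)`. -/
abbrev redSL (N : ℕ) (γ : SL(2, ℤ)) : Matrix (Fin 2) (Fin 2) (ZMod N) :=
  (SpecialLinearGroup.map (Int.castRingHom (ZMod N)) γ).1

lemma Ek_eq_mul_eisensteinSeries (k N : ℕ) (lam : ZMod N × ZMod N) (τ : ℍ) :
    Ek k N lam τ =
      (if 3 ≤ N then (1 : ℂ) else 1 / 2) * eisensteinSeries ![lam.1, lam.2] (k : ℤ) τ := by
  classical
  rw [Ek, eisensteinSeries, tsum_subtype (gammaSet N 1 ![lam.1, lam.2])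
    (fun v ↦ eisSummand (k : ℤ) v τ), ← (finTwoArrowEquiv ℤ).tsum_eq]
  congr 1
  refine tsum_congr fun v ↦ ?_
  rw [Set.indicator_apply]
  refine if_congr ?_ rfl rfl
  simp [gammaSet, funext_iff, Fin.forall_fin_two, and_comm]

/-- If `f` is a modular form for `Γ(N)` and `γ ∈ SL(2, ℤ)`, then so is `f ∣[k] γ`. -/
def ModularForm.slashGamma {N : ℕ} [NeZero N] {k : ℤ} (f : ModularForm Γ(N) k) (γ : SL(2, ℤ)) :
    ModularForm Γ(N) k where
  toFun := f ∣[k] γ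
  slash_action_eq' A hA := by
    obtain ⟨A, hA, rfl⟩ := hA
    have hconj : γ * A * γ⁻¹ ∈ Γ(N) := (Gamma_normal N).conj_mem A hA γ
    have hf : ⇑f ∣[k] (γ * A * γ⁻¹) = ⇑f :=
      SlashInvariantFormClass.slash_action_eq f _ (Subgroup.mem_map_of_mem _ hconj)
    change (⇑f ∣[k] γ) ∣[k] A = ⇑f ∣[k] γ
    rw [← SlashAction.slash_mul, show γ * A = (γ * A * γ⁻¹) * γ by simp, SlashAction.slash_mul, hf]
  holo' := (ModularFormClass.holo f).slash k (γ : GL (Fin 2) ℝ)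
  bdd_at_cusps' {c} hc := by
    rw [Subgroup.IsArithmetic.isCusp_iff_isCusp_SL2Z] at hc
    change c.IsBoundedAt (f ∣[k] (γ : GL (Fin 2) ℝ)) k
    rw [← OnePoint.IsBoundedAt.smul_iff]
    refine ModularFormClass.bdd_at_cusps f ?_
    rw [Subgroup.IsArithmetic.isCusp_iff_isCusp_SL2Z]
    exact hc.smul_of_mem ⟨γ, rfl⟩

lemma tendsto_valueAtInfty_of_Gamma {N : ℕ} [NeZero N] {k : ℤ} (f : ModularForm Γ(N) k) :
    Tendsto f atImInfty (𝓝 (valueAtInfty f)) := by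
  have hN : (0 : ℝ) < N := by exact_mod_cast NeZero.pos N
  have hp : (N : ℝ) ∈ (Γ(N) : Subgroup (GL (Fin 2) ℝ)).strictPeriods := by simp
  have : Fact (IsCusp OnePoint.infty (Γ(N) : Subgroup (GL (Fin 2) ℝ))) :=
    ⟨Subgroup.isCusp_of_mem_strictPeriods hN hp⟩
  have h := exp_decay_sub_atImInfty hN (SlashInvariantFormClass.periodic_comp_ofComplex f hp)
    (ModularFormClass.holo f) (ModularFormClass.bdd_at_infty f)
  have h0 : Tendsto (fun τ : ℍ ↦ Real.exp (-2 * Real.pi * τ.im / N)) atImInfty (𝓝 0) := by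
    refine Real.tendsto_exp_atBot.comp ?_
    have : Tendsto (fun τ : ℍ ↦ (-2 * Real.pi / N) * τ.im) atImInfty atBot :=
      tendsto_comap.const_mul_atTop_of_neg (div_neg_of_neg_of_pos (by simp [Real.pi_pos]) hN)
    exact this.congr fun τ ↦ by ring
  simpa using (h.trans_tendsto h0).add_const (valueAtInfty f)

lemma slash_apply_neg (k : ℤ) (f : ℍ → ℂ) (γ : SL(2, ℤ)) (τ : ℍ) :
    (f ∣[k] (-γ)) τ = (-1) ^ k * (f ∣[k] γ) τ := by
  rw [SL_slash_apply, SL_slash_apply, ModularGroup.SL_neg_smul]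
  have : denom (-γ : SL(2, ℤ)) τ = - denom γ τ := by
    simp [denom]; ring
  rw [this, neg_eq_neg_one_mul, mul_zpow, zpow_neg (-1 : ℂ)]
  rcases Int.even_or_odd k with h | h <;> simp [h.neg_one_zpow]

lemma vecMul_redSL (N : ℕ) (M : SL(2, ℤ)) :
    ![0, 1] ᵥ* redSL N M = ![(M 1 0 : ZMod N), (M 1 1 : ZMod N)] := by
  ext i
  fin_cases i <;> simp [vecMul, dotProduct, Fin.sum_univ_two]

/-- The translate by an element which is unipotent mod `N` does not change the value at `∞`. -/
lemma tendsto_slash_of_redSL {N : ℕ} [NeZero N] {k : ℤ} {f : ModularForm Γ(N) k}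
    {l : ℂ} (hf : Tendsto f atImInfty (𝓝 l)) {M : SL(2, ℤ)}
    (hM : ![0, 1] ᵥ* redSL N M = ![0, 1]) :
    Tendsto (f ∣[k] M) atImInfty (𝓝 l) := by
  rw [vecMul_redSL] at hM
  have h0 : (M 1 0 : ZMod N) = 0 := by
    simpa using congr_fun hM 0
  have h1 : (M 1 1 : ZMod N) = 1 := by
    simpa using congr_fun hM 1
  have h2 : (M 0 0 : ZMod N) = 1 := by
    have := congr_arg (Int.cast : ℤ → ZMod N) M.det_coe
    rw [det_fin_two] at this
    simpa [h0, h1] using this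
  set b := M 0 1
  have hmem : M * ModularGroup.T ^ (-b) ∈ Γ(N) := by
    rw [Gamma_mem]
    simp [ModularGroup.coe_T_zpow, Matrix.mul_apply, h0, h1, h2, b]
  have hMT : ⇑f ∣[k] M = ⇑f ∣[k] (ModularGroup.T ^ b) := by
    conv_lhs => rw [show M = (M * ModularGroup.T ^ (-b)) * ModularGroup.T ^ b by simp]
    rw [SlashAction.slash_mul]
    congr 1
    exact SlashInvariantFormClass.slash_action_eq f _ (Subgroup.mem_map_of_mem _ hmem)
  rw [hMT]
  have ht : Tendsto (fun τ : ℍ ↦ (b : ℝ) +ᵥ τ) atImInfty atImInfty := by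
    simpa [atImInfty, tendsto_comap_iff, Function.comp_def] using tendsto_comap
  refine (hf.comp ht).congr fun τ ↦ ?_
  rw [SL_slash_apply, modular_T_zpow_smul]
  have hden : denom (ModularGroup.T ^ b : SL(2, ℤ)) τ = 1 := by
    rw [ModularGroup.denom_apply, ModularGroup.coe_T_zpow]
    simp
  rw [hden]
  simp

lemma tendsto_eisensteinSeries {k : ℤ} (hk : 3 ≤ k) {N : ℕ} [NeZero N] (a : Fin 2 → ZMod N) :
    Tendsto (eisensteinSeries a k) atImInfty
      (𝓝 ((if a = ![0, 1] then 1 else 0) + (-1) ^ k * if a = -![0, 1] then 1 else 0)) := by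
  classical
  have hpos (n : ℕ) : 0 < ((n + 2 : ℕ) * Complex.I : ℂ).im := by simp; positivity
  let z (n : ℕ) : ℍ := ⟨(n + 2 : ℕ) * Complex.I, hpos n⟩
  have hzim (n : ℕ) : (z n).im = (n + 2 : ℕ) := by simp [z, UpperHalfPlane.im]
  have hzre (n : ℕ) : (z n).re = 0 := by simp [z, UpperHalfPlane.re]
  have hz : Tendsto z atTop atImInfty := by
    simpa only [atImInfty, tendsto_comap_iff, Function.comp_def, hzim] using
      tendsto_natCast_atTop_atTop.comp (tendsto_add_atTop_nat 2)
  have hlim : Tendsto (eisensteinSeries a k) atImInfty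
      (𝓝 (valueAtInfty (eisensteinSeries a k))) :=
    tendsto_valueAtInfty_of_Gamma (eisensteinSeriesMF hk a)
  let g (v : Fin 2 → ℤ) : ℂ := if v ∈ gammaSet N 1 a ∧ v 0 = 0 then (v 1 : ℂ) ^ (-k) else 0
  have key : Tendsto (fun n ↦ eisensteinSeries a k (z n)) atTop (𝓝 (∑' v, g v)) := by
    simp_rw [eisensteinSeries, fun n ↦ tsum_subtype (gammaSet N 1 a) (eisSummand k · (z n))]
    have hk' : (2 : ℝ) < k := by norm_cast
    refine tendsto_tsum_of_dominated_convergence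
      ((summable_one_div_norm_rpow hk').mul_left (r ⟨⟨0, 2⟩, Nat.ofNat_pos⟩ ^ (-k : ℝ))) ?_ ?_
    · intro v
      by_cases hv : v ∈ gammaSet N 1 a
      · simp only [Set.indicator_of_mem hv, g, hv, true_and]
        split_ifs with h0
        · simp [eisSummand, h0]
        · refine tendsto_zero_iff_norm_tendsto_zero.mpr ?_
          have htop : Tendsto (fun n ↦ ‖(v 0 * z n + v 1 : ℂ)‖) atTop atTop := by
            refine tendsto_atTop_mono (fun n ↦ ?_)
              (tendsto_natCast_atTop_atTop.comp (tendsto_add_atTop_nat 2))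
            refine le_trans ?_ (Complex.abs_im_le_norm _)
            have h1 : (1 : ℝ) ≤ |(v 0 : ℝ)| := by exact_mod_cast Int.one_le_abs h0
            have him : (v 0 * z n + v 1 : ℂ).im = v 0 * (n + 2 : ℕ) := by
              simp [← hzim]
            rw [him, abs_mul, Nat.abs_cast]
            exact le_mul_of_one_le_left (Nat.cast_nonneg _) h1
          simpa [eisSummand, norm_zpow, Function.comp_def] using
            (tendsto_zpow_atTop_zero (show -k < 0 by omega)).comp htop
      · simp [hv, g]
    · refine Eventually.of_forall fun n v ↦ ?_
      refine (norm_indicator_le_norm_self _ _).trans ?_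
      have hmem : z n ∈ verticalStrip 0 2 := by
        rw [mem_verticalStrip_iff, hzim, hzre]
        simp
      have := summand_bound_of_mem_verticalStrip (k := k) (by positivity) v two_pos hmem
      rw [eisSummand, norm_zpow]
      exact_mod_cast this
  rw [tendsto_nhds_unique (hlim.comp hz) key] at hlim
  convert hlim using 2
  have hne : (![0, 1] : Fin 2 → ℤ) ≠ ![0, -1] := by decide
  rw [tsum_eq_sum (s := {![0, 1], ![0, -1]}), Finset.sum_pair hne]
  · congr 1
    · simp [g, gammaSet, funext_iff, Fin.forall_fin_two, eq_comm]
    · rcases Int.even_or_odd k with h | h <;>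
        simp [g, gammaSet, funext_iff, Fin.forall_fin_two, eq_comm, h.neg_one_zpow]
  · intro v hv
    simp only [g, ite_eq_right_iff]
    rintro ⟨⟨-, hv1⟩, hv0⟩
    refine absurd ?_ hv
    rw [hv0, Int.gcd_zero_left] at hv1
    have : v = ![v 0, v 1] := by ext i; fin_cases i <;> rfl
    rw [this, hv0]
    rcases Int.natAbs_eq_iff.mp hv1 with h | h <;> simp [h]

lemma addOrderOf_vecMul_redSL {N : ℕ} (γ : SL(2, ℤ)) :
    addOrderOf ((![0, 1] ᵥ* redSL N γ) 0, (![0, 1] ᵥ* redSL N γ) 1) = N := by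
  rw [vecMul_redSL]
  have hmul (n : ℕ) : n • ((γ 1 0 : ZMod N), (γ 1 1 : ZMod N)) = 0 ↔ N ∣ n := by
    rw [← ZMod.natCast_eq_zero_iff]
    have hdet : (γ 0 0 * γ 1 1 - γ 0 1 * γ 1 0 : ZMod N) = 1 := by
      have := congr_arg (Int.cast : ℤ → ZMod N) γ.det_coe
      rw [det_fin_two] at this
      simpa using this
    simp only [Prod.smul_mk, nsmul_eq_mul, Prod.mk_eq_zero]
    constructor
    · rintro ⟨h0, h1⟩
      linear_combination (γ 0 0 : ZMod N) * h1 - (γ 0 1 : ZMod N) * h0 - n * hdet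
    · intro h
      simp [h]
  exact Nat.dvd_antisymm (addOrderOf_dvd_iff_nsmul_eq_zero.mpr ((hmul N).mpr dvd_rfl))
    ((hmul _).mp (addOrderOf_nsmul_eq_zero _))

lemma redSL_mul (N : ℕ) (γ δ : SL(2, ℤ)) : redSL N (γ * δ) = redSL N γ * redSL N δ := by
  simp only [redSL, map_mul]
  rfl

lemma redSL_one (N : ℕ) : redSL N 1 = 1 := by
  simp only [redSL, map_one]
  rfl

lemma vecMul_redSL_eq_iff {N : ℕ} (a b : Fin 2 → ZMod N) (γ : SL(2, ℤ)) :
    a ᵥ* redSL N γ = b ↔ a = b ᵥ* redSL N γ⁻¹ := by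
  have h1 : redSL N γ * redSL N γ⁻¹ = 1 := by rw [← redSL_mul, mul_inv_cancel, redSL_one]
  have h2 : redSL N γ⁻¹ * redSL N γ = 1 := by rw [← redSL_mul, inv_mul_cancel, redSL_one]
  constructor
  · rintro rfl
    rw [vecMul_vecMul, h1, vecMul_one]
  · rintro rfl
    rw [vecMul_vecMul, h2, vecMul_one]

lemma redSL_neg (N : ℕ) (γ : SL(2, ℤ)) : redSL N (-γ) = -redSL N γ := by
  ext i j
  simp

open Classical in
/-- The value of `f` at the cusp attached to `a`: if `a` is the reduction mod `N` of the
bottom row of `γ`, this is the value at `∞` of `f ∣[k] γ⁻¹`. -/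
def boundaryValue {N : ℕ} {k : ℤ} (f : ModularForm Γ(N) k) (a : Fin 2 → ZMod N) : ℂ :=
  if h : ∃ γ : SL(2, ℤ), ![0, 1] ᵥ* redSL N γ = a then valueAtInfty (⇑f ∣[k] h.choose⁻¹) else 0

section

variable {N : ℕ} [NeZero N] {k : ℤ} (f : ModularForm Γ(N) k)

lemma tendsto_slash (γ : SL(2, ℤ)) :
    Tendsto (⇑f ∣[k] γ) atImInfty (𝓝 (valueAtInfty (⇑f ∣[k] γ))) :=
  tendsto_valueAtInfty_of_Gamma (f.slashGamma γ)

lemma boundaryValue_vecMul (γ : SL(2, ℤ)) :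
    boundaryValue f (![0, 1] ᵥ* redSL N γ) = valueAtInfty (⇑f ∣[k] γ⁻¹) := by
  have h : ∃ δ : SL(2, ℤ), ![0, 1] ᵥ* redSL N δ = ![0, 1] ᵥ* redSL N γ := ⟨γ, rfl⟩
  rw [boundaryValue, dif_pos h]
  set δ := h.choose
  have hM : ![0, 1] ᵥ* redSL N (δ * γ⁻¹) = ![0, 1] := by
    rw [redSL_mul, ← vecMul_vecMul, vecMul_redSL_eq_iff, inv_inv]
    exact h.choose_spec
  have hδ : Tendsto (f.slashGamma δ⁻¹) atImInfty (𝓝 (valueAtInfty (⇑f ∣[k] δ⁻¹))) :=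
    tendsto_slash f δ⁻¹
  have := tendsto_slash_of_redSL hδ hM
  rw [show ⇑(f.slashGamma δ⁻¹) = ⇑f ∣[k] δ⁻¹ from rfl, ← SlashAction.slash_mul,
    inv_mul_cancel_left] at this
  exact tendsto_nhds_unique this (tendsto_slash f γ⁻¹)

lemma boundaryValue_neg_vecMul (γ : SL(2, ℤ)) :
    boundaryValue f (-![0, 1] ᵥ* redSL N γ) = (-1) ^ k * valueAtInfty (⇑f ∣[k] γ⁻¹) := by
  have h : -![0, 1] ᵥ* redSL N γ = ![0, 1] ᵥ* redSL N (-γ) := by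
    rw [redSL_neg, neg_vecMul, vecMul_neg]
  rw [h, boundaryValue_vecMul]
  refine tendsto_nhds_unique (tendsto_slash f _) ?_
  have hinv : (-γ)⁻¹ = -γ⁻¹ := inv_neg
  rw [hinv]
  exact ((tendsto_slash f γ⁻¹).const_mul _).congr fun τ ↦ (slash_apply_neg k f γ⁻¹ τ).symm

/-- The combination of Eisenstein series with the same values at all cusps as `f`. -/
def eisensteinPart (hk : 3 ≤ k) : ModularForm Γ(N) k :=
  ∑ a, (1 / 2 * boundaryValue f a) • eisensteinSeriesMF hk a

lemma eisensteinPart_coe (hk : 3 ≤ k) : ⇑(eisensteinPart f hk) =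
    ∑ a, (1 / 2 * boundaryValue f a) • eisensteinSeries a k := by
  rw [eisensteinPart, FunLike.coe_sum]
  rfl

lemma tendsto_eisensteinPart_slash (hk : 3 ≤ k) (γ : SL(2, ℤ)) :
    Tendsto (⇑(eisensteinPart f hk) ∣[k] γ) atImInfty (𝓝 (valueAtInfty (⇑f ∣[k] γ))) := by
  have h : ⇑(eisensteinPart f hk) ∣[k] γ =
      fun τ ↦ ∑ a, (1 / 2 * boundaryValue f a) * eisensteinSeries (a ᵥ* redSL N γ) k τ := by
    rw [eisensteinPart_coe, SlashAction.sum_slash]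
    ext τ
    simp [SL_smul_slash, eisensteinSeries_slash_apply]
  rw [h]
  have hlim : Tendsto (fun τ ↦ ∑ a,
      (1 / 2 * boundaryValue f a) * eisensteinSeries (a ᵥ* redSL N γ) k τ) atImInfty _ :=
    tendsto_finsetSum _ fun a _ ↦ (tendsto_eisensteinSeries hk (a ᵥ* redSL N γ)).const_mul _
  convert hlim using 2
  simp only [mul_add, Finset.sum_add_distrib, mul_ite, mul_one, mul_zero, vecMul_redSL_eq_iff,
    Finset.sum_ite_eq', Finset.mem_univ, if_true, boundaryValue_vecMul,
    boundaryValue_neg_vecMul, inv_inv]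
  rcases Int.even_or_odd k with h | h <;> rw [h.neg_one_zpow] <;> ring

/-- The difference of `f` and its Eisenstein part. -/
def cuspPart (hk : 3 ≤ k) : CuspForm Γ(N) k where
  toFun := ⇑(f - eisensteinPart f hk)
  slash_action_eq' := (f - eisensteinPart f hk).slash_action_eq'
  holo' := (f - eisensteinPart f hk).holo'
  zero_at_cusps' {c} hc := by
    rw [Subgroup.IsArithmetic.isCusp_iff_isCusp_SL2Z] at hc
    rw [OnePoint.isZeroAt_iff_forall_SL2Z hc]
    intro γ _
    have h : ⇑(f - eisensteinPart f hk) ∣[k] γ =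
        fun τ ↦ (⇑f ∣[k] γ) τ - (⇑(eisensteinPart f hk) ∣[k] γ) τ := by
      rw [FunLike.coe_sub, sub_eq_add_neg, SlashAction.add_slash, SlashAction.neg_slash]
      ext τ
      simp [sub_eq_add_neg]
    rw [h]
    simpa [IsZeroAtImInfty, ZeroAtFilter] using
      (tendsto_slash f γ).sub (tendsto_eisensteinPart_slash f hk γ)

end

/-- For `k ≥ 3`, every modular form of weight `k` on `Γ(N)` is the sum
of a linear combination of the Eisenstein series `E_k(·, λ̄, N)`, `λ̄ ∈ Λ_N`, and a
cusp form: `M_k(Γ(N)) = E_k(Γ(N),ℂ) + S_k(Γ(N))`. -/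
theorem modularForm_eq_eisenstein_add_cuspForm (k N : ℕ) (hk : 3 ≤ k) [NeZero N]
    (f : ModularForm (CongruenceSubgroup.Gamma N) (k : ℤ)) :
    ∃ (c : ZMod N × ZMod N → ℂ) (g : CuspForm (CongruenceSubgroup.Gamma N) (k : ℤ)),
      ∀ τ : ℍ, f τ =
        (∑ lam : ZMod N × ZMod N,
          if addOrderOf lam = N then c lam * Ek k N lam τ else 0) + g τ := by
  have hk' : (3 : ℤ) ≤ k := by exact_mod_cast hk
  have hε : (if 3 ≤ N then (1 : ℂ) else 1 / 2) ≠ 0 := by split_ifs <;> norm_num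
  refine ⟨fun lam ↦ (if 3 ≤ N then (1 : ℂ) else 1 / 2)⁻¹ *
    (1 / 2 * boundaryValue f ![lam.1, lam.2]), cuspPart f hk', fun τ ↦ ?_⟩
  suffices h : (∑ lam : ZMod N × ZMod N, if addOrderOf lam = N then
      (if 3 ≤ N then (1 : ℂ) else 1 / 2)⁻¹ * (1 / 2 * boundaryValue f ![lam.1, lam.2]) *
        Ek k N lam τ else 0) = eisensteinPart f hk' τ by
    rw [h]
    exact (add_sub_cancel _ _).symm
  rw [eisensteinPart_coe, Finset.sum_apply, ← (finTwoArrowEquiv (ZMod N)).symm.sum_comp]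
  refine Finset.sum_congr rfl fun lam _ ↦ ?_
  rw [Ek_eq_mul_eisensteinSeries]
  simp only [finTwoArrowEquiv_symm_apply, Pi.smul_apply, smul_eq_mul]
  by_cases h : addOrderOf lam = N
  · rw [if_pos h]
    field_simp
  · have hzero : boundaryValue f ![lam.1, lam.2] = 0 := by
      refine dif_neg ?_
      rintro ⟨γ, hγ⟩
      have := addOrderOf_vecMul_redSL (N := N) γ
      rw [hγ] at this
      exact h this
    simp [h, hzero]
end
end

section
/- Let N ≥ 1, let G be a subgroup of SL(2,ℤ) with Γ(N) ⊆ G and −Id ∉ G, and let γ₀ ∈ SL(2,ℤ). Set λ̄ := (0,1)·γ₀ ∈ (ℤ/Nℤ)², the row vector (0,1) multiplied on the right by the reduction of γ₀ modulo N. Then there exists γ ∈ G with λ̄·γ = −λ̄ if and only if there exists an integer h ≥ 1 with −T^h ∈ γ₀ G γ₀^{-1}. (Equivalently: the G-orbit of λ̄ in Λ_N is irregular, i.e. equals its own negative, exactly when the cusp G(γ₀^{-1}∞) of G is irregular.) -/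
open scoped MatrixGroups

noncomputable section

abbrev SL2Z := Matrix.SpecialLinearGroup (Fin 2) ℤ

/-- right action of `SL(2,ℤ)` on row vectors mod `N` -/
def rmul {N : ℕ} (lam : ZMod N × ZMod N) (γ : SL2Z) : ZMod N × ZMod N :=
  (lam.1 * ((γ 0 0 : ℤ) : ZMod N) + lam.2 * ((γ 1 0 : ℤ) : ZMod N),
   lam.1 * ((γ 0 1 : ℤ) : ZMod N) + lam.2 * ((γ 1 1 : ℤ) : ZMod N))

/-- `-Id` in `SL(2,ℤ)` -/
def negId : SL2Z := ⟨!![-1, 0; 0, -1], by norm_num [Matrix.det_fin_two_of]⟩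

theorem rmul_rmul {N : ℕ} (v : ZMod N × ZMod N) (g g' : SL2Z) :
    rmul (rmul v g) g' = rmul v (g * g') := by
  ext <;>
  · simp [rmul, Matrix.mul_apply, Fin.sum_univ_two]
    ring

theorem rmul_one {N : ℕ} (v : ZMod N × ZMod N) : rmul v 1 = v := by
  simp [rmul]

theorem rmul_neg {N : ℕ} (v : ZMod N × ZMod N) (g : SL2Z) : rmul (-v) g = -rmul v g := by
  ext <;>
  · simp [rmul]
    ring

theorem coe_negId_mul_T_pow (h : ℕ) :
    (negId * ModularGroup.T ^ h : SL2Z).1 = !![-1, -(h : ℤ); 0, -1] := by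
  have hT := ModularGroup.coe_T_zpow h
  rw [zpow_natCast] at hT
  rw [Matrix.SpecialLinearGroup.coe_mul, hT]
  simp [negId]

theorem rmul_negId_mul_T_pow {N : ℕ} (h : ℕ) :
    rmul ((0 : ZMod N), (1 : ZMod N)) (negId * ModularGroup.T ^ h) = -(0, 1) := by
  simp [rmul, coe_negId_mul_T_pow, -Matrix.SpecialLinearGroup.coe_mul]

/-- A matrix sending `(0,1)` to `-(0,1)` modulo `N` is congruent to some `-T^h`, `h ≥ 1`. -/
theorem exists_negId_mul_T_pow_mul_inv_mem_Gamma {N : ℕ} (hN : 0 < N) {δ : SL2Z}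
    (hδ : rmul ((0 : ZMod N), (1 : ZMod N)) δ = -(0, 1)) :
    ∃ h : ℕ, 1 ≤ h ∧ negId * ModularGroup.T ^ h * δ⁻¹ ∈ CongruenceSubgroup.Gamma N := by
  have : NeZero N := ⟨hN.ne'⟩
  obtain ⟨h10, h11⟩ : ((δ 1 0 : ℤ) : ZMod N) = 0 ∧ ((δ 1 1 : ℤ) : ZMod N) = -1 := by
    simpa [rmul] using hδ
  have h00 : ((δ 0 0 : ℤ) : ZMod N) = -1 := by
    have hdet := congrArg (Int.cast : ℤ → ZMod N) ((Matrix.det_fin_two δ.1).symm.trans δ.2)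
    push_cast at hdet
    rw [h10, h11] at hdet
    linear_combination -hdet
  refine ⟨(-((δ 0 1 : ℤ) : ZMod N)).val + N, by omega, ?_⟩
  rw [CongruenceSubgroup.Gamma_mem', map_mul, map_inv, mul_inv_eq_one]
  ext i j
  fin_cases i <;> fin_cases j <;>
    simp [coe_negId_mul_T_pow, h00, h10, h11, -map_mul, -Matrix.SpecialLinearGroup.coe_mul]

/-- For `Γ(N) ⊆ G` with `-Id ∉ G` and `γ₀ ∈ SL(2,ℤ)`, the `G`-orbit of
`λ̄ = (0,1)·γ₀` in `Λ_N` is irregular (some `γ ∈ G` sends `λ̄` to `-λ̄`) iff the cusp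
`G(γ₀⁻¹∞)` is irregular (i.e. `-T^h ∈ γ₀ G γ₀⁻¹` for some `h ≥ 1`). -/
theorem orbit_irregular_iff_cusp_irregular (N : ℕ) (hN : 0 < N) (G : Subgroup SL2Z)
    (hG : CongruenceSubgroup.Gamma N ≤ G) (hneg : negId ∉ G) (γ₀ : SL2Z) :
    (∃ γ ∈ G, rmul (rmul ((0 : ZMod N), (1 : ZMod N)) γ₀) γ
        = -(rmul ((0 : ZMod N), (1 : ZMod N)) γ₀)) ↔
      ∃ h : ℕ, 1 ≤ h ∧ γ₀⁻¹ * (negId * ModularGroup.T ^ h) * γ₀ ∈ G := by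
  constructor
  · rintro ⟨γ, hγ, hγv⟩
    have hδ : rmul ((0 : ZMod N), (1 : ZMod N)) (γ₀ * γ * γ₀⁻¹) = -(0, 1) := by
      rw [← rmul_rmul, ← rmul_rmul, hγv, rmul_neg, rmul_rmul, mul_inv_cancel, rmul_one]
    obtain ⟨h, h1, hmem⟩ := exists_negId_mul_T_pow_mul_inv_mem_Gamma hN hδ
    refine ⟨h, h1, ?_⟩
    have hconj := (CongruenceSubgroup.Gamma_normal N).conj_mem _ hmem γ₀⁻¹
    convert G.mul_mem (hG hconj) hγ using 1
    group
  · rintro ⟨h, -, hmem⟩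
    refine ⟨_, hmem, ?_⟩
    rw [rmul_rmul, ← mul_assoc, ← mul_assoc, mul_inv_cancel, one_mul, ← rmul_rmul,
      rmul_negId_mul_T_pow, rmul_neg]
end
end

section
/- Let k ≥ 2 and N ≥ 1 be integers and let m ∈ ℤ. Then Σ_{n ∈ ℤ∖{0}, n ≡ m (mod N)} n^{-k} = −((2πi)^k / (k!·N)) · Σ_{j=0}^{N−1} e(−jm/N) · B_k(j/N), where B_k is the k-th Bernoulli polynomial (defined by X·exp(tX)/(exp(X)−1) = Σ_{j ≥ 0} B_j(t)·X^j/j!) and the left-hand series converges absolutely. -/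
open Complex

noncomputable section

/-- Orthogonality of the additive characters of `ℤ/Nℤ`, with integer frequency `d`. -/
theorem sum_range_exp_mul_div (N : ℕ) (hN : N ≠ 0) (d : ℤ) :
    ∑ j ∈ Finset.range N, Complex.exp (2 * Real.pi * I * ((j : ℂ) * (d : ℂ) / (N : ℂ))) =
      if (N : ℤ) ∣ d then (N : ℂ) else 0 := by
  have hN' : (N : ℂ) ≠ 0 := Nat.cast_ne_zero.mpr hN
  have hpow (j : ℕ) : Complex.exp (2 * Real.pi * I * ((j : ℂ) * (d : ℂ) / (N : ℂ))) =
      Complex.exp (2 * Real.pi * I * ((d : ℂ) / (N : ℂ))) ^ j := by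
    rw [← Complex.exp_nat_mul]
    congr 1
    ring
  simp_rw [hpow]
  split_ifs with h
  · obtain ⟨c, rfl⟩ := h
    have : Complex.exp (2 * Real.pi * I * (((N * c : ℤ) : ℂ) / (N : ℂ))) = 1 :=
      Complex.exp_eq_one_iff.mpr ⟨c, by push_cast; field_simp⟩
    simp only [this, one_pow, Finset.sum_const, Finset.card_range, nsmul_eq_mul, mul_one]
  · have hne : Complex.exp (2 * Real.pi * I * ((d : ℂ) / (N : ℂ))) ≠ 1 := by
      intro h1
      obtain ⟨c, hc⟩ := Complex.exp_eq_one_iff.mp h1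
      apply h
      refine ⟨c, ?_⟩
      have h2 : (d : ℂ) / N = c :=
        mul_left_cancel₀ Complex.two_pi_I_ne_zero (hc.trans (mul_comm _ _))
      rw [div_eq_iff hN'] at h2
      have h3 : (d : ℂ) = ((N * c : ℤ) : ℂ) := by rw [h2]; push_cast; ring
      exact_mod_cast h3
    rw [geom_sum_eq hne, ← hpow, Complex.exp_eq_one_iff.mpr ⟨d, by field_simp⟩]
    simp

theorem hasSum_zpow_neg_of_congr (k N : ℕ) (hk : 2 ≤ k) (hN : 1 ≤ N) (m : ℤ) :
    HasSum (fun n : ℤ => if n ≠ 0 ∧ (n : ZMod N) = (m : ZMod N)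
        then ((n : ℂ)) ^ (-(k : ℤ)) else 0)
      (-((2 * Real.pi * I) ^ k / ((Nat.factorial k : ℂ) * (N : ℂ))) *
        ∑ j ∈ Finset.range N,
          Complex.exp (2 * Real.pi * I * (-((j : ℂ) * (m : ℂ)) / (N : ℂ))) *
            (((Polynomial.bernoulli k).eval ((j : ℚ) / (N : ℚ)) : ℚ) : ℂ)) := by
  have hN0 : N ≠ 0 := by omega
  have hN' : (N : ℂ) ≠ 0 := Nat.cast_ne_zero.mpr hN0
  have hbern (j : ℕ) : ((bernoulliFun k ((j : ℝ) / N) : ℝ) : ℂ) =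
      (((Polynomial.bernoulli k).eval ((j : ℚ) / (N : ℚ)) : ℚ) : ℂ) := by
    have := Polynomial.eval_map_apply (p := Polynomial.bernoulli k) (algebraMap ℚ ℝ)
      ((j : ℚ) / (N : ℚ))
    simp only [eq_ratCast, Rat.cast_div, Rat.cast_natCast] at this
    rw [bernoulliFun, this, Complex.ofReal_ratCast]
  have hterm (j : ℕ) (hj : j ∈ Finset.range N) := ((hasSum_one_div_pow_mul_fourier_mul_bernoulliFun
    hk (x := (j : ℝ) / N) ⟨by positivity, div_le_one_of_le₀
      (by exact_mod_cast (Finset.mem_range.mp hj).le) (by positivity)⟩).mul_left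
      (Complex.exp (2 * Real.pi * I * (-((j : ℂ) * (m : ℂ)) / (N : ℂ)))))
  convert! (hasSum_sum hterm).mul_left ((N : ℂ)⁻¹) using 1
  · ext n
    have hsum : ∑ j ∈ Finset.range N,
        Complex.exp (2 * Real.pi * I * (-((j : ℂ) * (m : ℂ)) / (N : ℂ))) *
          (1 / (n : ℂ) ^ k * fourier n (((j : ℝ) / N : ℝ) : AddCircle (1 : ℝ))) =
        1 / (n : ℂ) ^ k * if (N : ℤ) ∣ n - m then (N : ℂ) else 0 := by
      rw [← sum_range_exp_mul_div N hN0, Finset.mul_sum]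
      refine Finset.sum_congr rfl fun j _ => ?_
      rw [fourier_coe_apply, mul_left_comm, ← Complex.exp_add]
      congr 2
      push_cast
      field_simp
      ring
    have hiff : (n : ZMod N) = (m : ZMod N) ↔ (N : ℤ) ∣ n - m := by
      rw [eq_comm, ZMod.intCast_eq_intCast_iff_dvd_sub]
    rw [hsum]
    simp only [hiff]
    by_cases hn : n = 0
    · simp [hn, show k ≠ 0 by omega]
    · by_cases hd : (N : ℤ) ∣ n - m
      · simp [hn, hd]
        field_simp
      · simp [hd]
  · rw [Finset.mul_sum, Finset.mul_sum]
    refine Finset.sum_congr rfl fun j _ => ?_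
    rw [hbern]
    field_simp

/-- For `k ≥ 2`, `N ≥ 1` and `m ∈ ℤ`, the absolutely convergent series
`Σ_{n ∈ ℤ∖{0}, n ≡ m (N)} n^{-k}` equals
`−((2πi)^k/(k!·N))·Σ_{j=0}^{N−1} e(−jm/N)·B_k(j/N)`. -/
theorem sum_inv_pow_eq_bernoulli (k N : ℕ) (hk : 2 ≤ k) (hN : 1 ≤ N) (m : ℤ) :
    Summable (fun n : ℤ =>
      if n ≠ 0 ∧ (n : ZMod N) = (m : ZMod N) then ‖((n : ℂ)) ^ (-(k : ℤ))‖ else 0) ∧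
    (∑' n : ℤ, if n ≠ 0 ∧ (n : ZMod N) = (m : ZMod N)
        then ((n : ℂ)) ^ (-(k : ℤ)) else 0) =
      -((2 * Real.pi * I) ^ k / ((Nat.factorial k : ℂ) * (N : ℂ))) *
        ∑ j ∈ Finset.range N,
          Complex.exp (2 * Real.pi * I * (-((j : ℂ) * (m : ℂ)) / (N : ℂ))) *
            (((Polynomial.bernoulli k).eval ((j : ℚ) / (N : ℚ)) : ℚ) : ℂ) := by
  have h := hasSum_zpow_neg_of_congr k N hk hN m
  refine ⟨h.summable.norm.congr fun n => ?_, h.tsum_eq⟩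
  split_ifs <;> simp
end
end

section
/- Let N ≥ 1, let δ be a positive divisor of N, and let χ be a Dirichlet character modulo N with values in ℂ. Then the following are equivalent: (a) there exist Dirichlet characters χ₁ modulo N/δ and χ₂ modulo δ such that χ equals the product of the level-raisings of χ₁ and χ₂ to modulus N (i.e. χ is δ-good); (b) χ factors through modulus lcm(δ, N/δ), i.e. there exists a Dirichlet character ψ modulo lcm(δ, N/δ) whose level-raising to modulus N equals χ. -/
/-- Characters of a finite commutative group with values in `ℂˣ` extend along injective
homomorphisms. -/
theorem MonoidHom.exists_comp_eq_of_injective {G H : Type*} [CommGroup G] [CommGroup H] [Finite H]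
    (f : G →* H) (hf : Function.Injective f) (ψ : G →* ℂˣ) : ∃ φ : H →* ℂˣ, φ.comp f = ψ := by
  have : NeZero (Monoid.exponent H) := ⟨Monoid.exponent_ne_zero_of_finite⟩
  obtain ⟨φ, hφ⟩ := MonoidHom.domRestrict_surjective ℂ f.range
    (ψ.comp (MonoidHom.ofInjective hf).symm.toMonoidHom)
  refine ⟨φ, MonoidHom.ext fun g ↦ ?_⟩
  have h := DFunLike.congr_fun hφ (MonoidHom.ofInjective hf g)
  simpa [MonoidHom.ofInjective_apply] using h

/-- A unit modulo `lcm m n` is determined by its reductions modulo `m` and modulo `n`. -/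
theorem ZMod.unitsMap_prod_lcm_injective (m n : ℕ) :
    Function.Injective ((ZMod.unitsMap (Nat.dvd_lcm_left m n)).prod
      (ZMod.unitsMap (Nat.dvd_lcm_right m n))) := by
  rw [injective_iff_map_eq_one]
  intro u hu
  obtain ⟨h₁, h₂⟩ := Prod.ext_iff.mp hu
  replace h₁ := congrArg Units.val h₁
  replace h₂ := congrArg Units.val h₂
  obtain ⟨z, hz⟩ := ZMod.intCast_surjective (u : ZMod (Nat.lcm m n))
  simp only [MonoidHom.prod_apply, ZMod.unitsMap_val, ← hz, Prod.fst_one, Prod.snd_one,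
    Units.val_one, ZMod.cast_intCast (Nat.dvd_lcm_left m n),
    ZMod.cast_intCast (Nat.dvd_lcm_right m n)] at h₁ h₂
  rw [← Int.cast_one, ZMod.intCast_eq_intCast_iff_dvd_sub] at h₁ h₂
  rw [Units.ext_iff, ← hz, Units.val_one, ← Int.cast_one, ZMod.intCast_eq_intCast_iff_dvd_sub]
  exact Int.coe_lcm_dvd h₁ h₂

/-- Every complex Dirichlet character modulo `lcm m n` is a product of characters induced from
moduli `m` and `n`. -/
theorem DirichletCharacter.exists_eq_changeLevel_mul_changeLevel_of_lcm {m n : ℕ} [NeZero m]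
    [NeZero n] (ψ : DirichletCharacter ℂ (Nat.lcm m n)) :
    ∃ (ψ₁ : DirichletCharacter ℂ m) (ψ₂ : DirichletCharacter ℂ n),
      ψ = changeLevel (Nat.dvd_lcm_left m n) ψ₁ * changeLevel (Nat.dvd_lcm_right m n) ψ₂ := by
  obtain ⟨φ, hφ⟩ := MonoidHom.exists_comp_eq_of_injective _
    (ZMod.unitsMap_prod_lcm_injective m n) ψ.toUnitHom
  refine ⟨MulChar.ofUnitHom (φ.comp (MonoidHom.inl _ _)),
    MulChar.ofUnitHom (φ.comp (MonoidHom.inr _ _)), MulChar.ext fun u ↦ ?_⟩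
  rw [← MulChar.coe_toUnitHom ψ, ← hφ]
  simp [changeLevel_def, ← Units.val_mul, ← map_mul]


/-- A Dirichlet character `χ` mod `N` is `δ`-good (a product of
level-raisings of characters mod `N/δ` and mod `δ`) iff it factors through modulus
`lcm(δ, N/δ)`. -/
theorem deltaGood_iff_factors_through_lcm (N : ℕ) (hN : 1 ≤ N) (δ : ℕ) (hδ : 0 < δ)
    (hdvd : δ ∣ N) (χ : DirichletCharacter ℂ N) :
    (∃ (χ₁ : DirichletCharacter ℂ (N / δ)) (χ₂ : DirichletCharacter ℂ δ),
        χ = DirichletCharacter.changeLevel (Nat.div_dvd_of_dvd hdvd) χ₁ *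
            DirichletCharacter.changeLevel hdvd χ₂) ↔
      ∃ ψ : DirichletCharacter ℂ (Nat.lcm δ (N / δ)),
        χ = DirichletCharacter.changeLevel
          (Nat.lcm_dvd hdvd (Nat.div_dvd_of_dvd hdvd)) ψ := by
  have : NeZero δ := ⟨hδ.ne'⟩
  have : NeZero (N / δ) := ⟨(Nat.div_pos (Nat.le_of_dvd hN hdvd) hδ).ne'⟩
  have hlcm := Nat.lcm_dvd hdvd (Nat.div_dvd_of_dvd hdvd)
  constructor
  · rintro ⟨χ₁, χ₂, rfl⟩
    refine ⟨DirichletCharacter.changeLevel (Nat.dvd_lcm_right _ _) χ₁ *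
      DirichletCharacter.changeLevel (Nat.dvd_lcm_left _ _) χ₂, ?_⟩
    rw [map_mul, ← DirichletCharacter.changeLevel_trans _ _ hlcm,
      ← DirichletCharacter.changeLevel_trans _ _ hlcm]
  · rintro ⟨ψ, rfl⟩
    obtain ⟨ψ₂, ψ₁, rfl⟩ := ψ.exists_eq_changeLevel_mul_changeLevel_of_lcm
    refine ⟨ψ₁, ψ₂, ?_⟩
    rw [map_mul, ← DirichletCharacter.changeLevel_trans _ _ hlcm,
      ← DirichletCharacter.changeLevel_trans _ _ hlcm, mul_comm]
end

section
/- Let N ≥ 1, let t be a positive divisor of N, let k ≥ 3, and let λ = (λ₁, λ₂) ∈ ℤ² with gcd(λ₁, λ₂, N) = 1. Set δ₁ := gcd(λ₁, N), δ_t := gcd(t·λ₁, N), and G_k^{(t)}(λ, N) := Σ_{n=0}^{N/δ_t − 1} G_k(·, (λ₁, λ₂ + δ_t·n) mod N, N). Then for every τ in the upper half-plane: G_k^{(t)}(λ, N)(τ) = Σ_{j=0}^{∞} A_j · e(j·δ₁·τ/δ_t), where A_0 = [N ∣ λ₁] · Σ_{n ∈ ℤ∖{0}, n ≡ λ₂ (mod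 δ_t)} n^{-k} (with [N ∣ λ₁] the indicator that N divides λ₁), and for j ≥ 1, A_j = ((−2πi)^k / ((k−1)!·δ_t^k)) · Σ_{r ∈ ℤ∖{0}, r ∣ j, j/r ≡ λ₁/δ₁ (mod N/δ₁)} sgn(r)·r^{k−1}·e(r·λ₂/δ_t). -/
open Complex UpperHalfPlane

noncomputable section

/-- unnormalized Eisenstein series of weight `k` on `Γ(N)` -/
def Gk (k N : ℕ) (lam : ZMod N × ZMod N) : ℍ → ℂ :=
  fun τ => ∑' cd : ℤ × ℤ,
    if cd ≠ (0, 0) ∧ (cd.1 : ZMod N) = lam.1 ∧ (cd.2 : ZMod N) = lam.2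
    then ((cd.1 : ℂ) * (τ : ℂ) + (cd.2 : ℂ)) ^ (-(k : ℤ)) else 0

/-- Lipschitz's formula for a sum over a residue class. -/
theorem tsum_residueClass_add_zpow {k D : ℕ} (hk : 2 ≤ k) (hD : 0 < D) (l : ℤ) (z : ℍ) :
    ∑' d : ℤ, (if (d : ZMod D) = (l : ZMod D) then ((z : ℂ) + d) ^ (-(k : ℤ)) else 0) =
      (-(2 * Real.pi * Complex.I)) ^ k / ((Nat.factorial (k - 1) : ℂ) * (D : ℂ) ^ k) *
        ∑' r : ℕ+, (r : ℂ) ^ (k - 1) * cexp (2 * Real.pi * Complex.I * r * l / D) *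
          cexp (2 * Real.pi * Complex.I * r * z / D) := by
  have hD' : (D : ℂ) ≠ 0 := by exact_mod_cast hD.ne'
  have hinj : Function.Injective (fun m : ℤ => l + D * m) := fun a b h => by
    simpa [hD.ne'] using h
  have him : 0 < (((z : ℂ) + l) / D).im := by
    rw [Complex.div_natCast_im]
    have := z.im_pos
    have : (0 : ℝ) < D := by exact_mod_cast hD
    simp only [add_im, intCast_im, add_zero, coe_im]
    positivity
  have H := EisensteinSeries.qExpansion_identity_pnat (k := k - 1) (by omega) ⟨_, him⟩
  rw [show k - 1 + 1 = k by omega] at H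
  rw [← hinj.tsum_eq]
  · have h1 : ∀ m : ℤ, (if ((l + D * m : ℤ) : ZMod D) = (l : ZMod D) then
        ((z : ℂ) + (l + D * m : ℤ)) ^ (-(k : ℤ)) else 0) =
        ((D : ℂ) ^ k)⁻¹ * (1 / (((z : ℂ) + l) / D + m) ^ k) := by
      intro m
      rw [if_pos (by simp), zpow_neg, zpow_natCast, one_div, ← mul_inv, ← mul_pow]
      congr 2
      push_cast
      field_simp
      ring
    simp only [h1]
    rw [tsum_mul_left, H, ← mul_assoc]
    congr 1
    · rw [neg_mul, neg_mul]; field_simp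
    · refine tsum_congr fun r => ?_
      rw [← Complex.exp_nat_mul, mul_assoc (_ ^ _), ← Complex.exp_add]
      congr 2
      field_simp
      ring
  · intro d hd
    have : (d : ZMod D) = (l : ZMod D) := by
      by_contra h
      simp [h] at hd
    obtain ⟨m, hm⟩ := (ZMod.intCast_eq_intCast_iff_dvd_sub _ _ _).1 this.symm
    exact ⟨m, by simp only [← hm]; ring⟩

/-- The inner sum of an Eisenstein series over a residue class, for a fixed nonzero first
coordinate. -/
theorem tsum_residueClass_mul_add_zpow {k D : ℕ} (hk : 2 ≤ k) (hD : 0 < D) (l : ℤ) (τ : ℍ)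
    {c : ℤ} (hc : c ≠ 0) :
    ∑' d : ℤ, (if (d : ZMod D) = (l : ZMod D) then ((c : ℂ) * τ + d) ^ (-(k : ℤ)) else 0) =
      (-(2 * Real.pi * Complex.I)) ^ k / ((Nat.factorial (k - 1) : ℂ) * (D : ℂ) ^ k) *
        ∑' r : ℤ, if 0 < r * c then (Int.sign r : ℂ) * (r : ℂ) ^ (k - 1) *
          cexp (2 * Real.pi * Complex.I * r * l / D) * cexp (2 * Real.pi * Complex.I * r * (c * τ) / D) else 0 := by
  rcases hc.lt_or_gt with hc | hc
  · have him : 0 < (((-c : ℤ) : ℂ) * τ).im := by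
      have := τ.im_pos
      have : (0 : ℝ) < (-c : ℤ) := by exact_mod_cast neg_pos.2 hc
      rw [← Complex.ofReal_intCast, Complex.im_ofReal_mul]
      simp only [coe_im]
      positivity
    have H := tsum_residueClass_add_zpow hk hD (-l) ⟨_, him⟩
    rw [← tsum_comp_neg]
    have h1 : ∀ d : ℤ, (if ((-d : ℤ) : ZMod D) = (l : ZMod D) then
        ((c : ℂ) * τ + (-d : ℤ)) ^ (-(k : ℤ)) else 0) =
        (-1) ^ k * (if (d : ZMod D) = ((-l : ℤ) : ZMod D) then
          (((-c : ℤ) : ℂ) * τ + d) ^ (-(k : ℤ)) else 0) := by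
      intro d
      have : ((-d : ℤ) : ZMod D) = (l : ZMod D) ↔ (d : ZMod D) = ((-l : ℤ) : ZMod D) := by
        push_cast; exact neg_eq_iff_eq_neg
      simp only [this, mul_ite, mul_zero]
      congr 1
      rw [show (c : ℂ) * τ + (-d : ℤ) = -(((-c : ℤ) : ℂ) * τ + d) by push_cast; ring,
        zpow_neg, zpow_neg, zpow_natCast, zpow_natCast, neg_pow, mul_inv, ← inv_pow]
      norm_num
    simp only [h1]
    rw [tsum_mul_left, H, mul_left_comm]
    congr 1
    have hinj : Function.Injective (fun n : ℕ+ => -((n : ℕ) : ℤ)) := fun a b h => by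
      simpa using h
    rw [← hinj.tsum_eq, ← tsum_mul_left]
    · refine tsum_congr fun r => ?_
      have hr : 0 < ((r : ℕ) : ℤ) := by exact_mod_cast r.pos
      rw [if_pos (by nlinarith), Int.sign_eq_neg_one_of_neg (by omega), mul_assoc (_ ^ (k - 1)),
        mul_assoc (((-1 : ℤ) : ℂ) * _),
        ← Complex.exp_add, ← Complex.exp_add]
      obtain ⟨m, rfl⟩ : ∃ m, k = m + 1 := ⟨k - 1, by omega⟩
      push_cast
      rw [neg_pow (r : ℂ) m, ← mul_assoc, ← mul_assoc]
      congr 1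
      · ring
      · congr 1
        ring
    · intro r hr
      have : 0 < r * c := by
        by_contra h
        simp [h] at hr
      have hr : r < 0 := by nlinarith
      exact ⟨⟨r.natAbs, by omega⟩, by simp only [PNat.mk_coe]; omega⟩
  · have him : 0 < ((c : ℂ) * τ).im := by
      have := τ.im_pos
      have : (0 : ℝ) < c := by exact_mod_cast hc
      rw [← Complex.ofReal_intCast, Complex.im_ofReal_mul]
      simp only [coe_im]
      positivity
    have H := tsum_residueClass_add_zpow hk hD l ⟨_, him⟩
    rw [H]
    congr 1
    have hinj : Function.Injective (fun n : ℕ+ => ((n : ℕ) : ℤ)) := fun a b h => by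
      simpa using h
    rw [← hinj.tsum_eq]
    · refine tsum_congr fun r => ?_
      have hr : 0 < ((r : ℕ) : ℤ) := by exact_mod_cast r.pos
      rw [if_pos (by positivity), Int.sign_eq_one_of_pos hr]
      push_cast
      rw [one_mul]
    · intro r hr
      have : 0 < r * c := by
        by_contra h
        simp [h] at hr
      have hr : 0 < r := by nlinarith
      exact ⟨⟨r.natAbs, by omega⟩, by simp only [PNat.mk_coe]; omega⟩

theorem summable_ite_natAbs_pow_mul_pow (m : ℕ) {q : ℝ} (hq0 : 0 ≤ q) (hq : q < 1) :
    Summable fun p : ℤ × ℤ => if 0 < p.2 * p.1 then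
      (p.2.natAbs : ℝ) ^ m * q ^ (p.2 * p.1).natAbs else 0 := by
  set B : ℤ × ℤ → ℝ := fun p => if 0 < p.1 ∧ 0 < p.2 then
      (p.2.natAbs : ℝ) ^ m * q ^ (p.2 * p.1).natAbs else 0 with hB
  have hinj : Function.Injective (fun p : ℕ+ × ℕ+ => (((p.1 : ℕ) : ℤ), ((p.2 : ℕ) : ℤ))) :=
    fun a b h => by
      simp only [Prod.mk.injEq, Nat.cast_inj, PNat.coe_inj] at h
      exact Prod.ext h.1 h.2
  have hBs : Summable B := by
    rw [← hinj.summable_iff]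
    · refine (summable_prod_mul_pow m (r := q) (by rwa [Real.norm_of_nonneg hq0])).congr
        fun p => ?_
      simp [hB, mul_comm, Int.natAbs_mul]
    · rintro ⟨c, r⟩ h
      refine if_neg fun ⟨h1, h2⟩ => h ?_
      simp only at h1 h2
      exact ⟨(⟨c.natAbs, by omega⟩, ⟨r.natAbs, by omega⟩), by
        ext <;> simp only [PNat.mk_coe] <;> omega⟩
  refine (hBs.add ((Equiv.neg (ℤ × ℤ)).summable_iff.2 hBs)).congr fun p => ?_
  obtain ⟨c, r⟩ := p
  simp only [hB, Function.comp_apply, Equiv.neg_apply, Prod.neg_mk, neg_mul_neg, Int.natAbs_neg,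
    mul_pos_iff (a := r) (b := c)]
  grind

theorem summable_divisorTerm (k D : ℕ) (hD : 0 < D) (l : ℤ) (τ : ℍ) :
    Summable fun p : ℤ × ℤ => if 0 < p.2 * p.1 then
      (Int.sign p.2 : ℂ) * (p.2 : ℂ) ^ (k - 1) * cexp (2 * Real.pi * Complex.I * p.2 * l / D) *
        cexp (2 * Real.pi * Complex.I * p.2 * (p.1 * τ) / D) else 0 := by
  have hD' : (0 : ℝ) < D := by exact_mod_cast hD
  refine (summable_ite_natAbs_pow_mul_pow (k - 1) (q := Real.exp (-(2 * Real.pi * τ.im / D)))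
    (Real.exp_pos _).le ?_).of_norm_bounded ?_
  · rw [Real.exp_lt_one_iff, neg_lt_zero]
    have := τ.im_pos
    positivity
  · rintro ⟨c, r⟩
    simp only
    split_ifs with h
    · have hr : r ≠ 0 := by rintro rfl; simp at h
      have hs : ‖((Int.sign r : ℤ) : ℂ)‖ = 1 := by
        rcases hr.lt_or_gt with h | h
        · simp [Int.sign_eq_neg_one_of_neg h]
        · simp [Int.sign_eq_one_of_pos h]
      have h1 : ‖cexp (2 * Real.pi * Complex.I * r * l / D)‖ = 1 := by
        rw [show (2 * Real.pi * Complex.I * r * l / D : ℂ) = ((2 * Real.pi * r * l / D : ℝ) : ℂ) * Complex.I by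
          push_cast; ring, Complex.norm_exp_ofReal_mul_I]
      have h2 : ‖cexp (2 * Real.pi * Complex.I * r * (c * τ) / D)‖ =
          Real.exp (-(2 * Real.pi * τ.im / D)) ^ (r * c).natAbs := by
        rw [Complex.norm_exp, ← Real.exp_nat_mul]
        have : (((r * c).natAbs : ℕ) : ℝ) = r * c := by
          rw [Nat.cast_natAbs, abs_of_pos h]; push_cast; rfl
        rw [this, show (2 * Real.pi * Complex.I * r * (c * τ) / D : ℂ) =
          ((2 * Real.pi * r * c / D : ℝ) : ℂ) * (Complex.I * τ) by push_cast; ring, Complex.re_ofReal_mul]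
        congr 1
        simp
        ring
      rw [norm_mul, norm_mul, norm_mul, hs, h1, h2, norm_pow, Complex.norm_intCast,
        Nat.cast_natAbs]
      simp
    · simp

theorem summable_ite_mul_add_zpow {k : ℕ} (hk : 3 ≤ k) (τ : ℍ) (P : ℤ × ℤ → Prop)
    [DecidablePred P] :
    Summable fun cd : ℤ × ℤ =>
      if P cd then ((cd.1 : ℂ) * (τ : ℂ) + (cd.2 : ℂ)) ^ (-(k : ℤ)) else 0 := by
  refine (summable_prod_eisSummand hk τ).norm.of_norm_bounded fun cd => ?_
  split_ifs
  · simp [EisensteinSeries.eisSummand]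
  · simp

theorem sum_range_ite_residueClass {N D : ℕ} (hN : 0 < N) (hDN : D ∣ N) (l d : ℤ) (P : Prop)
    [Decidable P] (x : ℂ) :
    ∑ n ∈ Finset.range (N / D),
        (if P ∧ (d : ZMod N) = ((l + (D : ℤ) * (n : ℤ) : ℤ) : ZMod N) then x else 0) =
      if P ∧ (d : ZMod D) = (l : ZMod D) then x else 0 := by
  obtain ⟨M, rfl⟩ := hDN
  have hD : 0 < D := Nat.pos_of_mul_pos_right hN
  have hM : 0 < M := Nat.pos_of_mul_pos_left hN
  rw [Nat.mul_div_cancel_left _ hD]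
  by_cases hP : P
  swap
  · simp [hP]
  simp only [hP, true_and]
  by_cases hd : (d : ZMod D) = (l : ZMod D)
  · obtain ⟨m, hm⟩ := (ZMod.intCast_eq_intCast_iff_dvd_sub _ _ _).1 hd.symm
    have hM' : (0 : ℤ) < M := by exact_mod_cast hM
    have key : ∀ n : ℤ, ((d : ZMod (D * M)) = ((l + (D : ℤ) * n : ℤ) : ZMod (D * M))) ↔
        (M : ℤ) ∣ n - m := by
      intro n
      rw [ZMod.intCast_eq_intCast_iff_dvd_sub, show l + (D : ℤ) * n - d = D * (n - m) by
        rw [mul_sub, ← hm]; ring]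
      push_cast
      exact mul_dvd_mul_iff_left (by exact_mod_cast hD.ne')
    simp only [key]
    have h0 := Int.emod_nonneg m hM'.ne'
    have h1 := Int.emod_lt_of_pos m hM'
    rw [if_pos hd, Finset.sum_eq_single (m % M).toNat]
    · rw [if_pos]
      rw [Int.toNat_of_nonneg h0]
      exact Int.ModEq.dvd (Int.mod_modEq m M).symm
    · intro n hn hne
      refine if_neg fun h => hne ?_
      have h2 : (n : ℤ) % M = m % M :=
        Int.emod_eq_emod_iff_emod_sub_eq_zero.2 (Int.emod_eq_zero_of_dvd h)
      rw [Int.emod_eq_of_lt (by positivity) (by exact_mod_cast Finset.mem_range.1 hn)] at h2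
      omega
    · intro h
      exact absurd (Finset.mem_range.2 (by omega)) h
  · rw [if_neg hd]
    refine Finset.sum_eq_zero fun n _ => if_neg fun h => hd ?_
    rw [ZMod.intCast_eq_intCast_iff_dvd_sub] at h
    have : ((D : ℤ)) ∣ l + D * n - d := (by push_cast; exact dvd_mul_right _ _ :
      (D : ℤ) ∣ ((D * M : ℕ) : ℤ)).trans h
    rw [ZMod.intCast_eq_intCast_iff_dvd_sub]
    have := dvd_sub this (dvd_mul_right (D : ℤ) n)
    rwa [show l + D * n - d - (D : ℤ) * n = l - d by ring] at this

/-- The orbital sum of Eisenstein series is the sum of `(c τ + d) ^ (-k)` over the nonzero `(c, d)`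
with `c ≡ a mod N` and `d ≡ l mod D`. -/
theorem sum_Gk_eq_tsum {N D k : ℕ} (hN : 0 < N) (hDN : D ∣ N) (hk : 3 ≤ k) (a l : ℤ) (τ : ℍ) :
    ∑ n ∈ Finset.range (N / D),
        Gk k N ((a : ZMod N), ((l + (D : ℤ) * (n : ℤ) : ℤ) : ZMod N)) τ =
      ∑' cd : ℤ × ℤ, if (cd ≠ (0, 0) ∧ (cd.1 : ZMod N) = a) ∧ (cd.2 : ZMod D) = l
        then ((cd.1 : ℂ) * (τ : ℂ) + (cd.2 : ℂ)) ^ (-(k : ℤ)) else 0 := by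
  unfold Gk
  rw [← Summable.tsum_finsetSum fun n _ => summable_ite_mul_add_zpow hk τ _]
  refine tsum_congr fun cd => ?_
  rw [← sum_range_ite_residueClass hN hDN]
  simp only [and_assoc]

/-- Regrouping of a double sum over `(c, r)` with `r c > 0` and `c ≡ a mod N` according to the
value of `r c / δ`, where `δ` divides `a` and `N`. -/
theorem hasSum_mul_pos_iff {N δ : ℕ} (hN : 0 < N) (hδN : δ ∣ N) {a : ℤ} (hδa : (δ : ℤ) ∣ a)
    (f : ℤ → ℂ) (e : ℤ → ℂ) (s : ℂ) :
    HasSum (fun p : ℤ × ℤ => if (p.1 : ZMod N) = a then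
        (if 0 < p.2 * p.1 then f p.2 * e (p.2 * p.1) else 0) else 0) s ↔
      HasSum (fun p : ℕ × ℤ => if p.1 = 0 then 0 else
        (if p.2 ≠ 0 ∧ p.2 ∣ (p.1 : ℤ) ∧
          (((p.1 : ℤ) / p.2 : ℤ) : ZMod (N / δ)) = ((a / (δ : ℤ) : ℤ) : ZMod (N / δ))
        then f p.2 else 0) * e (p.1 * δ)) s := by
  obtain ⟨M, rfl⟩ := hδN
  obtain ⟨b, rfl⟩ := hδa
  have hδ : 0 < δ := Nat.pos_of_mul_pos_right hN
  have hδ' : (0 : ℤ) < δ := by exact_mod_cast hδ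
  rw [Nat.mul_div_cancel_left _ hδ, Int.mul_ediv_cancel_left _ hδ'.ne']
  have key : ∀ c : ℤ, (((δ * c : ℤ) : ZMod (δ * M)) = ((δ * b : ℤ) : ZMod (δ * M))) ↔
      (c : ZMod M) = (b : ZMod M) := by
    intro c
    rw [ZMod.intCast_eq_intCast_iff_dvd_sub, ZMod.intCast_eq_intCast_iff_dvd_sub, ← mul_sub]
    push_cast
    exact mul_dvd_mul_iff_left hδ'.ne'
  set g : ℕ × ℤ → ℂ := fun p => if p.1 = 0 then 0 else
        (if p.2 ≠ 0 ∧ p.2 ∣ (p.1 : ℤ) ∧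
          (((p.1 : ℤ) / p.2 : ℤ) : ZMod M) = (b : ZMod M)
        then f p.2 else 0) * e (p.1 * δ) with hg
  have hsupp : ∀ p : Function.support g, p.1.1 ≠ 0 ∧ p.1.2 ≠ 0 ∧ p.1.2 ∣ (p.1.1 : ℤ) ∧
      (((p.1.1 : ℤ) / p.1.2 : ℤ) : ZMod M) = (b : ZMod M) := by
    rintro ⟨⟨j, r⟩, hp⟩
    by_contra h
    apply hp
    simp only [hg]
    grind
  refine hasSum_iff_hasSum_of_ne_zero_bij (fun p => ((δ : ℤ) * (p.1.1 / p.1.2), p.1.2)) ?_ ?_ ?_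
  · intro p p' h
    obtain ⟨-, hr, hdvd, -⟩ := hsupp p
    obtain ⟨-, -, hdvd', -⟩ := hsupp p'
    simp only [Prod.mk.injEq, mul_eq_mul_left_iff, hδ'.ne', or_false] at h
    obtain ⟨h1, h2⟩ := h
    ext
    · have := Int.ediv_mul_cancel hdvd
      rw [h1, h2, Int.ediv_mul_cancel hdvd'] at this
      exact_mod_cast this.symm
    · exact h2
  · rintro ⟨c, r⟩ hp
    have hca : (c : ZMod (δ * M)) = ((δ * b : ℤ) : ZMod (δ * M)) := by
      by_contra h
      exact hp (if_neg h)
    have hrc : 0 < r * c := by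
      by_contra h
      exact hp (by simp only [if_neg h, ite_self])
    obtain ⟨c, rfl⟩ : (δ : ℤ) ∣ c := by
      rw [ZMod.intCast_eq_intCast_iff_dvd_sub] at hca
      have := (by push_cast; exact dvd_mul_right _ _ :
        (δ : ℤ) ∣ ((δ * M : ℕ) : ℤ)).trans hca
      exact (dvd_sub_right (dvd_mul_right _ _)).1 this
    have hr : r ≠ 0 := by rintro rfl; simp at hrc
    have hrc' : 0 < r * c := by
      rw [mul_left_comm] at hrc
      exact pos_of_mul_pos_right hrc hδ'.le
    have hcast : (((r * c).toNat : ℕ) : ℤ) = r * c := Int.toNat_of_nonneg hrc'.le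
    have hdiv : r * c / r = c := Int.mul_ediv_cancel_left _ hr
    refine ⟨⟨((r * c).toNat, r), ?_⟩, ?_⟩
    · have h2 : f r * e (r * (δ * c)) ≠ 0 := by
        simpa [hca, hrc] using hp
      rw [Function.mem_support]
      simp only [hg, hcast, hdiv, (key c).1 hca]
      rw [if_neg (by omega), if_pos ⟨hr, dvd_mul_right _ _, trivial⟩]
      convert h2 using 3
      ring
    · simp only [hcast, hdiv]
  · intro p
    obtain ⟨hj, hr, hdvd, hc⟩ := hsupp p
    obtain ⟨⟨j, r⟩, hp⟩ := p
    simp only at hj hr hdvd hc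
    have h1 : r * (δ * (j / r)) = j * (δ : ℤ) := by
      rw [mul_left_comm, Int.mul_ediv_cancel' hdvd, mul_comm]
    have h2 : 0 < (j : ℤ) * δ := by positivity
    simp only [hg, h1]
    rw [if_pos ((key _).2 hc), if_pos h2, if_neg hj, if_pos ⟨hr, hdvd, hc⟩]

/-- The Fourier expansion of an orbital sum of Eisenstein series, for arbitrary divisors `D` and `δ`
of `N` with `δ ∣ a`. -/
theorem sum_Gk_eq_tsum_exp {N D δ k : ℕ} (hN : 0 < N) (hD : 0 < D) (hDN : D ∣ N) (hδN : δ ∣ N)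
    (hk : 3 ≤ k) {a : ℤ} (hδa : (δ : ℤ) ∣ a) (l : ℤ) (τ : ℍ) :
    ∑ n ∈ Finset.range (N / D),
        Gk k N ((a : ZMod N), ((l + (D : ℤ) * (n : ℤ) : ℤ) : ZMod N)) τ =
      ∑' j : ℕ,
        (if j = 0 then
          (if (N : ℤ) ∣ a then (1 : ℂ) else 0) *
            ∑' n : ℤ, (if n ≠ 0 ∧ (n : ZMod D) = (l : ZMod D) then (n : ℂ) ^ (-(k : ℤ)) else 0)
        else
          ((-(2 * Real.pi * Complex.I)) ^ k / ((Nat.factorial (k - 1) : ℂ) * (D : ℂ) ^ k)) *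
            ∑' r : ℤ,
              (if r ≠ 0 ∧ r ∣ (j : ℤ) ∧
                  (((j : ℤ) / r : ℤ) : ZMod (N / δ)) = ((a / (δ : ℤ) : ℤ) : ZMod (N / δ))
               then ((Int.sign r : ℤ) : ℂ) * (r : ℂ) ^ (k - 1) *
                 cexp (2 * Real.pi * Complex.I * (r : ℂ) * (l : ℂ) / (D : ℂ))
               else 0)) *
        cexp (2 * Real.pi * Complex.I * (j : ℂ) * (δ : ℂ) * (τ : ℂ) / (D : ℂ)) := by
  set C : ℂ := (-(2 * Real.pi * Complex.I)) ^ k / ((Nat.factorial (k - 1) : ℂ) * (D : ℂ) ^ k)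
  set A₀ : ℂ := (if (N : ℤ) ∣ a then (1 : ℂ) else 0) *
    ∑' n : ℤ, (if n ≠ 0 ∧ (n : ZMod D) = (l : ZMod D) then (n : ℂ) ^ (-(k : ℤ)) else 0) with hA₀
  set f : ℤ → ℂ := fun r => ((Int.sign r : ℤ) : ℂ) * (r : ℂ) ^ (k - 1) *
    cexp (2 * Real.pi * Complex.I * (r : ℂ) * (l : ℂ) / (D : ℂ)) with hf
  set e : ℤ → ℂ := fun m => cexp (2 * Real.pi * Complex.I * m * τ / D) with he
  have hfe : ∀ c r : ℤ, f r * e (r * c) =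
      (Int.sign r : ℂ) * (r : ℂ) ^ (k - 1) * cexp (2 * Real.pi * Complex.I * r * l / D) *
        cexp (2 * Real.pi * Complex.I * r * (c * τ) / D) := fun c r => by
    simp only [hf, he]
    push_cast
    congr 2
    ring
  set H : ℤ × ℤ → ℂ := fun p => if (p.1 : ZMod N) = a then
        (if 0 < p.2 * p.1 then f p.2 * e (p.2 * p.1) else 0) else 0 with hH
  have hHs : Summable H := by
    simp only [hH, hfe]
    exact ((summable_divisorTerm k D hD l τ).indicator {p | (p.1 : ZMod N) = a}).congr
      fun p => by simp only [Set.indicator_apply, Set.mem_ofPred_eq]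
  have hinner : ∀ c : ℤ, (∑' d : ℤ, if ((c, d) ≠ ((0, 0) : ℤ × ℤ) ∧ (c : ZMod N) = a) ∧
      (d : ZMod D) = l then ((c : ℂ) * (τ : ℂ) + (d : ℂ)) ^ (-(k : ℤ)) else 0) =
      (if c = 0 then A₀ else 0) + C * ∑' r : ℤ, H (c, r) := by
    intro c
    rcases eq_or_ne c 0 with rfl | hc
    · have h0 : ((0 : ℤ) : ZMod N) = a ↔ (N : ℤ) ∣ a := by
        rw [ZMod.intCast_eq_intCast_iff_dvd_sub, sub_zero]
      simp only [hH, h0, mul_zero, lt_irrefl, if_false, ite_self, tsum_zero, add_zero, if_true, hA₀]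
      split_ifs with h <;> simp [h]
    · simp only [hc, if_false, zero_add, hH, ne_eq, Prod.mk.injEq, false_and, not_false_iff,
        true_and]
      by_cases h : (c : ZMod N) = a
      · simp only [h, if_true, true_and, hfe]
        exact tsum_residueClass_mul_add_zpow (by omega) hD l τ hc
      · simp [h]
  have hL : HasSum (fun c : ℤ => (if c = 0 then A₀ else 0) + C * ∑' r : ℤ, H (c, r))
      (A₀ + C * ∑' p, H p) :=
    (hasSum_ite_eq 0 A₀).add
      ((hHs.hasSum.prod_fiberwise fun c => (hHs.prod_factor c).hasSum).mul_left C)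
  rw [sum_Gk_eq_tsum hN hDN hk, (summable_ite_mul_add_zpow hk τ _).tsum_prod]
  simp only [hinner]
  rw [hL.tsum_eq]
  have hK := (hasSum_mul_pos_iff hN hδN hδa f e _).1 hHs.hasSum
  refine (((hasSum_ite_eq 0 A₀).add ((hK.prod_fiberwise fun j =>
    (hK.summable.prod_factor j).hasSum).mul_left C)).congr_fun fun j => ?_).tsum_eq.symm
  rcases eq_or_ne j 0 with rfl | hj
  · simp
  · simp only [hj, if_false, zero_add, tsum_mul_right, ← mul_assoc C, he, hf]
    push_cast
    congr 2
    ring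

/-- The Fourier expansion of the unnormalized orbital sum
`G_k^{(t)}(λ, N) = Σ_{n<N/δ_t} G_k(·, (λ₁, λ₂+δ_t n), N)` for the group `Γ(N,t)`. -/
theorem fourier_expansion_Gkt (N t k : ℕ) (hN : 1 ≤ N) (ht : 0 < t) (htdvd : t ∣ N)
    (hk : 3 ≤ k) (lam : ℤ × ℤ) (hlam : Int.gcd lam.1 (Int.gcd lam.2 (N : ℤ)) = 1) :
    ∀ τ : ℍ,
      (∑ n ∈ Finset.range (N / Int.gcd ((t : ℤ) * lam.1) (N : ℤ)),
        Gk k N ((lam.1 : ZMod N),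
          ((lam.2 + (Int.gcd ((t : ℤ) * lam.1) (N : ℤ) : ℤ) * (n : ℤ) : ℤ) : ZMod N)) τ) =
      ∑' j : ℕ,
        (if j = 0 then
          (if (N : ℤ) ∣ lam.1 then (1 : ℂ) else 0) *
            ∑' n : ℤ,
              (if n ≠ 0 ∧
                  (n : ZMod (Int.gcd ((t : ℤ) * lam.1) (N : ℤ))) =
                    ((lam.2 : ℤ) : ZMod (Int.gcd ((t : ℤ) * lam.1) (N : ℤ)))
               then ((n : ℂ)) ^ (-(k : ℤ)) else 0)
        else
          ((-(2 * Real.pi * Complex.I)) ^ k /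
              ((Nat.factorial (k - 1) : ℂ) * ((Int.gcd ((t : ℤ) * lam.1) (N : ℤ) : ℕ) : ℂ) ^ k)) *
            ∑' r : ℤ,
              (if r ≠ 0 ∧ r ∣ (j : ℤ) ∧
                  (((j : ℤ) / r : ℤ) : ZMod (N / Int.gcd lam.1 (N : ℤ))) =
                    ((lam.1 / (Int.gcd lam.1 (N : ℤ) : ℤ) : ℤ) : ZMod (N / Int.gcd lam.1 (N : ℤ)))
               then ((Int.sign r : ℤ) : ℂ) * ((r : ℂ)) ^ (k - 1) *
                 Complex.exp (2 * Real.pi * Complex.I * (r : ℂ) * ((lam.2 : ℤ) : ℂ) /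
                   ((Int.gcd ((t : ℤ) * lam.1) (N : ℤ) : ℕ) : ℂ))
               else 0)) *
        Complex.exp (2 * Real.pi * Complex.I * (j : ℂ) *
          ((Int.gcd lam.1 (N : ℤ) : ℕ) : ℂ) * (τ : ℂ) /
          ((Int.gcd ((t : ℤ) * lam.1) (N : ℤ) : ℕ) : ℂ)) := by
  intro τ
  obtain ⟨l₁, l₂⟩ := lam
  simp only
  have hN' : (N : ℤ) ≠ 0 := by omega
  refine sum_Gk_eq_tsum_exp hN (Int.gcd_pos_of_ne_zero_right _ hN') ?_ ?_ hk
    (Int.gcd_dvd_left _ _) l₂ τ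
  · exact_mod_cast Int.gcd_dvd_right ((t : ℤ) * l₁) (N : ℤ)
  · exact_mod_cast Int.gcd_dvd_right l₁ (N : ℤ)
end
end
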